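/- For a centered, absolutely-continuous log-concave probability measure μ on ℝⁿ with density f, the differential entropy satisfies -log f(0) ≤ Ent(μ) ≤ -log f(0) + n, where Ent(μ) = -∫ f log f. -/

import Mathlib

open MeasureTheory

/-- Pointwise log-concavity of a nonnegative function, in multiplicative form. -/
def IsLogConcave {E : Type*} [AddCommGroup E] [Module ℝ E] (f : E → ℝ) : Prop :=
  ∀ x y : E, ∀ t : ℝ, 0 ≤ t → t ≤ 1 → f x ^ t * f y ^ (1 - t) ≤ f (t • x + (1 - t) • y)

theorem Real.mul_one_add_mul_log_le_rpow {a : ℝ} (ha : 0 ≤ a) (t : ℝ) :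
    a * (1 + (t - 1) * Real.log a) ≤ a ^ t := by
  rcases ha.eq_or_lt with rfl | ha
  · simpa using Real.rpow_nonneg le_rfl t
  · have h : a ^ t = a * Real.exp ((t - 1) * Real.log a) := by
      rw [Real.rpow_def_of_pos ha]
      nth_rewrite 2 [← Real.exp_log ha]
      rw [← Real.exp_add]
      ring_nf
    rw [h]
    have := Real.add_one_le_exp ((t - 1) * Real.log a)
    gcongr
    linarith

theorem Real.neg_mul_log_le_two_mul_rpow {a : ℝ} (ha : 0 ≤ a) :
    -(a * Real.log a) ≤ 2 * a ^ (1 / 2 : ℝ) := by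
  have := Real.mul_one_add_mul_log_le_rpow ha (1 / 2)
  linarith

namespace IsLogConcave

section Convex

variable {E : Type*} [AddCommGroup E] [Module ℝ E] {f : E → ℝ}

theorem convex_support (hf : IsLogConcave f) : Convex ℝ {x | 0 < f x} := by
  intro x hx y hy a b ha hb hab
  obtain rfl : b = 1 - a := by linarith
  exact (mul_pos (Real.rpow_pos_of_pos hx _) (Real.rpow_pos_of_pos hy _)).trans_le
    (hf x y a ha (by linarith))

theorem mul_log_add_mul_log_le (hf : IsLogConcave f) {x y : E} (hx : 0 < f x) (hy : 0 < f y)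
    {t : ℝ} (ht : 0 ≤ t) (ht' : t ≤ 1) :
    t * Real.log (f x) + (1 - t) * Real.log (f y) ≤ Real.log (f (t • x + (1 - t) • y)) := by
  have hx' := Real.rpow_pos_of_pos hx t
  have hy' := Real.rpow_pos_of_pos hy (1 - t)
  have := Real.log_le_log (mul_pos hx' hy') (hf x y t ht ht')
  rwa [Real.log_mul hx'.ne' hy'.ne', Real.log_rpow hx, Real.log_rpow hy] at this

theorem concaveOn_log (hf : IsLogConcave f) :
    ConcaveOn ℝ {x | 0 < f x} (fun x => Real.log (f x)) := by
  refine ⟨hf.convex_support, fun x hx y hy a b ha hb hab => ?_⟩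
  obtain rfl : b = 1 - a := by linarith
  exact hf.mul_log_add_mul_log_le hx hy ha (by linarith)

theorem comp_add_left (hf : IsLogConcave f) (c : E) : IsLogConcave (fun x => f (c + x)) := by
  intro x y t ht ht'
  convert hf (c + x) (c + y) t ht ht' using 2
  module

/-- Comparison of `f ^ t` with the dilation `f (t • ·)`. -/
theorem rpow_le_comp_smul (hf : IsLogConcave f) (h₀ : 0 < f 0) {t : ℝ}
    (ht : 0 ≤ t) (ht' : t ≤ 1) (x : E) : f x ^ t ≤ f 0 ^ (t - 1) * f (t • x) := by
  have h := hf x 0 t ht ht'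
  rw [smul_zero, add_zero] at h
  calc f x ^ t = f 0 ^ (t - 1) * (f x ^ t * f 0 ^ (1 - t)) := by
        rw [mul_left_comm, ← Real.rpow_add h₀]
        simp
    _ ≤ _ := by gcongr

end Convex

theorem pos_of_mem_interior_support {E : Type*} [TopologicalSpace E] {f : E → ℝ} {x : E}
    (hx : x ∈ interior {x | 0 < f x}) : 0 < f x :=
  interior_subset (s := {x | 0 < f x}) hx

variable {E : Type*} [NormedAddCommGroup E] [NormedSpace ℝ E] [FiniteDimensional ℝ E] {f : E → ℝ}

/-- A log-concave function has a supergradient of its logarithm at each interior point of its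
support. -/
theorem exists_log_le_add (hf : IsLogConcave f) {x₀ : E} (hx₀ : x₀ ∈ interior {x | 0 < f x}) :
    ∃ l : E →L[ℝ] ℝ, ∀ x, 0 < f x → Real.log (f x) ≤ Real.log (f x₀) + l (x - x₀) := by
  have hU := hf.concaveOn_log.subset interior_subset hf.convex_support.interior
  have hcont := hU.continuousOn isOpen_interior
  have hpos := pos_of_mem_interior_support hx₀
  set U := interior {x | 0 < f x}
  have hopen : IsOpen {p : E × ℝ | p.1 ∈ U ∧ p.2 < Real.log (f p.1)} := by
    have hc : ContinuousOn (fun p : E × ℝ => Real.log (f p.1) - p.2) (U ×ˢ Set.univ) :=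
      (hcont.comp continuousOn_fst fun p hp => hp.1).sub continuousOn_snd
    have := hc.isOpen_inter_preimage (isOpen_interior.prod isOpen_univ) (isOpen_Ioi (a := 0))
    convert this using 1
    ext p
    simp
  obtain ⟨L, hL⟩ := geometric_hahn_banach_open_point hU.convex_strict_hypograph hopen
    (x := (x₀, Real.log (f x₀))) (by simp)
  have hsplit : ∀ (x : E) (s : ℝ), L (x, s) = L (x, 0) + s * L (0, 1) := by
    intro x s
    have h : ((x, s) : E × ℝ) = (x, 0) + s • (0, 1) := by simp
    rw [h, map_add, map_smul, smul_eq_mul]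
  set c := L (0, 1)
  have hc : 0 < c := by
    have := hL (x₀, Real.log (f x₀) - 1) ⟨hx₀, by simp⟩
    rw [hsplit, hsplit x₀ (Real.log (f x₀))] at this
    linarith
  have hUle : ∀ x ∈ U, Real.log (f x) ≤ Real.log (f x₀) + (-c⁻¹) * L (x - x₀, 0) := by
    intro x hx
    refine le_of_forall_lt fun s hs => ?_
    have := hL (x, s) ⟨hx, hs⟩
    rw [hsplit, hsplit x₀ (Real.log (f x₀))] at this
    have hsub : L (x - x₀, 0) = L (x, 0) - L (x₀, 0) := by
      rw [← map_sub]
      simp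
    rw [hsub, ← sub_pos]
    have : 0 < c⁻¹ * (L (x₀, 0) + Real.log (f x₀) * c - (L (x, 0) + s * c)) :=
      mul_pos (inv_pos.2 hc) (by linarith)
    linear_combination this + (Real.log (f x₀) - s) * mul_inv_cancel₀ hc.ne'
  refine ⟨(-c⁻¹) • L.comp (.inl ℝ E ℝ), fun x hx => ?_⟩
  have hm : (1 / 2 : ℝ) • x₀ + (1 - 1 / 2 : ℝ) • x ∈ U :=
    hf.convex_support.combo_interior_self_mem_interior hx₀ hx (by norm_num) (by norm_num)
      (by norm_num)
  have h₁ := hUle _ hm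
  have h₂ := hf.mul_log_add_mul_log_le hpos hx (t := 1 / 2)
    (by norm_num) (by norm_num)
  have h₃ : (((1 / 2 : ℝ) • x₀ + (1 - 1 / 2 : ℝ) • x - x₀, 0) : E × ℝ) =
      (1 / 2 : ℝ) • (x - x₀, 0) := by
    ext
    · simp only [Prod.smul_mk]
      module
    · simp
  rw [h₃, map_smul] at h₁
  simp only [smul_eq_mul] at h₁
  simp only [smul_apply, ContinuousLinearMap.comp_apply,
    ContinuousLinearMap.inl_apply, smul_eq_mul]
  linarith

variable [MeasurableSpace E] [BorelSpace E] {μ : Measure E} [μ.IsAddHaarMeasure]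

theorem nonempty_interior_support (hf : IsLogConcave f) (hf₀ : ∀ x, 0 ≤ f x)
    (hint : ∫ x, f x ∂μ ≠ 0) : (interior {x | 0 < f x}).Nonempty := by
  by_contra h
  rw [Set.not_nonempty_iff_eq_empty] at h
  have hnull : μ {x | 0 < f x} = 0 := by
    refine measure_mono_null ?_ (hf.convex_support.addHaar_frontier μ)
    rw [frontier, h, Set.sdiff_empty]
    exact subset_closure
  apply hint
  rw [integral_eq_zero_of_ae]
  filter_upwards [measure_eq_zero_iff_ae_notMem.1 hnull] with x hx
  exact le_antisymm (not_lt.1 hx) (hf₀ x)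

theorem integrable_rpow (hf : IsLogConcave f) (hf₀ : ∀ x, 0 ≤ f x) (h₀ : 0 < f 0)
    (hint : Integrable f μ) {t : ℝ} (ht : 0 < t) (ht' : t ≤ 1) :
    Integrable (fun x => f x ^ t) μ := by
  refine Integrable.mono' (((integrable_comp_smul_iff μ f ht.ne').2 hint).const_mul (f 0 ^ (t - 1)))
    (hint.aemeasurable.pow_const t).aestronglyMeasurable (.of_forall fun x => ?_)
  rw [Real.norm_of_nonneg (Real.rpow_nonneg (hf₀ x) t)]
  exact hf.rpow_le_comp_smul h₀ ht.le ht' x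

theorem integral_rpow_le (hf : IsLogConcave f) (hf₀ : ∀ x, 0 ≤ f x) (h₀ : 0 < f 0)
    (hint : Integrable f μ) {t : ℝ} (ht : 0 < t) (ht' : t ≤ 1) :
    ∫ x, f x ^ t ∂μ ≤ f 0 ^ (t - 1) * ((t ^ Module.finrank ℝ E)⁻¹ * ∫ x, f x ∂μ) := by
  have := integral_mono (hf.integrable_rpow hf₀ h₀ hint ht ht')
    (((integrable_comp_smul_iff μ f ht.ne').2 hint).const_mul (f 0 ^ (t - 1)))
    (fun x => hf.rpow_le_comp_smul h₀ ht.le ht' x)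
  rwa [integral_const_mul, Measure.integral_comp_smul_of_nonneg μ f t (hR := ht.le),
    smul_eq_mul] at this

/-- An integrable log-concave function drops below half of its value at an interior point of its
support outside of a ball. -/
theorem exists_forall_le_half (hf : IsLogConcave f) (hf₀ : ∀ x, 0 ≤ f x)
    (h₀ : (0 : E) ∈ interior {x | 0 < f x}) (hint : Integrable f μ) :
    ∃ R > 0, ∀ x, R ≤ ‖x‖ → f x ≤ f 0 / 2 := by
  have hpos : 0 < f 0 := pos_of_mem_interior_support h₀
  have hcont : ContinuousAt (fun x => Real.log (f x)) 0 :=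
    hf.concaveOn_log.continuousOn_interior.continuousAt (isOpen_interior.mem_nhds h₀)
  have hev : ∀ᶠ y in nhds (0 : E), f 0 / 2 < f y := by
    filter_upwards [hcont.eventually_const_lt
      (Real.log_lt_log (half_pos hpos) (half_lt_self hpos)), mem_interior_iff_mem_nhds.1 h₀]
      with y hy hy'
    exact (Real.log_lt_log_iff (half_pos hpos) hy').1 hy
  obtain ⟨r, hr, hball⟩ := Metric.eventually_nhds_iff_ball.1 hev
  have hV : 0 < μ.real (Metric.ball (0 : E) (r / 2)) :=
    ENNReal.toReal_pos (Metric.measure_ball_pos μ _ (half_pos hr)).ne' measure_ball_lt_top.ne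
  have htail : Filter.Tendsto (fun k : ℕ => ∫ x in {x : E | (k : ℝ) ≤ ‖x‖}, f x ∂μ) Filter.atTop
      (nhds 0) := by
    have := tendsto_setIntegral_of_antitone (μ := μ) (f := f)
      (s := fun k : ℕ => {x : E | (k : ℝ) ≤ ‖x‖})
      (fun k => measurableSet_le measurable_const measurable_norm)
      (fun i j hij x (hx : (j : ℝ) ≤ ‖x‖) => (Nat.cast_le.2 hij).trans hx) ⟨0, hint.integrableOn⟩
    convert this
    have hemp : ⋂ k : ℕ, {x : E | (k : ℝ) ≤ ‖x‖} = ∅ := by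
      refine Set.eq_empty_of_forall_notMem fun x hx => ?_
      obtain ⟨k, hk⟩ := exists_nat_gt ‖x‖
      exact (Set.mem_iInter.1 hx k).not_gt hk
    simp [hemp]
  obtain ⟨k, hk⟩ := (htail.eventually_lt_const (mul_pos (half_pos hpos) hV)).exists
  refine ⟨2 * k + r, by positivity, fun x hx => ?_⟩
  by_contra! hfx
  have hsub : Metric.ball ((1 / 2 : ℝ) • x) (r / 2) ⊆ {x : E | (k : ℝ) ≤ ‖x‖} := by
    intro z hz
    have h₁ : ‖(1 / 2 : ℝ) • x‖ ≤ ‖z‖ + ‖z - (1 / 2 : ℝ) • x‖ := by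
      have := norm_sub_le z (z - (1 / 2 : ℝ) • x)
      simpa using this
    rw [mem_ball_iff_norm] at hz
    rw [norm_smul, Real.norm_of_nonneg (by norm_num)] at h₁
    change (k : ℝ) ≤ ‖z‖
    linarith
  have hlow : ∀ z ∈ Metric.ball ((1 / 2 : ℝ) • x) (r / 2), f 0 / 2 ≤ f z := by
    intro z hz
    have hy : (2 : ℝ) • z - x ∈ Metric.ball (0 : E) r := by
      rw [mem_ball_iff_norm] at hz ⊢
      have : (2 : ℝ) • z - x - 0 = (2 : ℝ) • (z - (1 / 2 : ℝ) • x) := by module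
      rw [this, norm_smul, Real.norm_of_nonneg (by norm_num)]
      linarith
    have h := hf x ((2 : ℝ) • z - x) (1 / 2) (by norm_num) (by norm_num)
    have hz' : (1 / 2 : ℝ) • x + (1 - 1 / 2 : ℝ) • ((2 : ℝ) • z - x) = z := by module
    rw [hz'] at h
    refine le_trans ?_ h
    calc f 0 / 2 = (f 0 / 2) ^ (1 / 2 : ℝ) * (f 0 / 2) ^ (1 - 1 / 2 : ℝ) := by
          rw [← Real.rpow_add (half_pos hpos)]
          norm_num
      _ ≤ _ := by
          have := (hball _ hy).le
          have := Real.rpow_nonneg (hf₀ x) (1 / 2)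
          gcongr
  have h₁ : f 0 / 2 * μ.real (Metric.ball (0 : E) (r / 2)) ≤
      ∫ z in Metric.ball ((1 / 2 : ℝ) • x) (r / 2), f z ∂μ := by
    have := setIntegral_mono_on (μ := μ) (integrableOn_const (C := f 0 / 2) measure_ball_lt_top.ne)
      hint.integrableOn measurableSet_ball hlow
    rwa [setIntegral_const, smul_eq_mul, mul_comm, measureReal_def, Measure.addHaar_ball_center,
      ← measureReal_def] at this
  have h₂ : ∫ z in Metric.ball ((1 / 2 : ℝ) • x) (r / 2), f z ∂μ ≤
      ∫ z in {x : E | (k : ℝ) ≤ ‖x‖}, f z ∂μ :=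
    setIntegral_mono_set hint.integrableOn (.of_forall fun x => hf₀ x) (.of_forall hsub)
  linarith

theorem integrable_norm_mul_of_zero_mem (hf : IsLogConcave f) (hf₀ : ∀ x, 0 ≤ f x)
    (h₀ : (0 : E) ∈ interior {x | 0 < f x}) (hint : Integrable f μ) :
    Integrable (fun x => ‖x‖ * f x) μ := by
  have hpos : 0 < f 0 := pos_of_mem_interior_support h₀
  obtain ⟨R, hR, hRf⟩ := hf.exists_forall_le_half hf₀ h₀ hint
  have hdom : Integrable (fun x => R * f x + R / Real.log 2 *
      (|Real.log (f 0)| * f x + 2 * f x ^ (1 / 2 : ℝ))) μ :=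
    (hint.const_mul R).add (((hint.const_mul _).add
      ((hf.integrable_rpow hf₀ hpos hint (by norm_num) (by norm_num)).const_mul 2)).const_mul _)
  refine hdom.mono' (continuous_norm.aestronglyMeasurable.mul hint.1) (.of_forall fun x => ?_)
  have hfx := hf₀ x
  rw [Real.norm_of_nonneg (mul_nonneg (norm_nonneg x) hfx)]
  have hlog2 : 0 < Real.log 2 := Real.log_pos one_lt_two
  have hsqrt : 0 ≤ f x ^ (1 / 2 : ℝ) := Real.rpow_nonneg hfx _
  rcases le_total ‖x‖ R with hx | hx
  · have : ‖x‖ * f x ≤ R * f x := by gcongr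
    have : 0 ≤ R / Real.log 2 * (|Real.log (f 0)| * f x + 2 * f x ^ (1 / 2 : ℝ)) := by positivity
    linarith
  rcases hfx.eq_or_lt with hfx0 | hfx'
  · rw [← hfx0]
    simp only [mul_zero, zero_add]
    positivity
  have hxpos : 0 < ‖x‖ := hR.trans_le hx
  have ht : 0 ≤ 1 - R / ‖x‖ := sub_nonneg.2 ((div_le_one hxpos).2 hx)
  have h₁ := hf.mul_log_add_mul_log_le hfx' hpos (t := R / ‖x‖) (by positivity) (sub_nonneg.1 ht)
  have hpt : 0 < f ((R / ‖x‖) • x + (1 - R / ‖x‖) • (0 : E)) :=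
    hf.convex_support hfx' hpos (by positivity) ht (by ring)
  have h₂ := Real.log_le_log hpt (hRf ((R / ‖x‖) • x + (1 - R / ‖x‖) • (0 : E)) (by
    rw [smul_zero, add_zero, norm_smul, Real.norm_of_nonneg (by positivity),
      div_mul_cancel₀ _ hxpos.ne']))
  rw [Real.log_div hpos.ne' two_ne_zero] at h₂
  have h₃ : ‖x‖ * Real.log 2 ≤ R * (Real.log (f 0) - Real.log (f x)) := by
    have h : Real.log 2 ≤ R / ‖x‖ * (Real.log (f 0) - Real.log (f x)) := by linarith
    calc ‖x‖ * Real.log 2 ≤ ‖x‖ * (R / ‖x‖ * (Real.log (f 0) - Real.log (f x))) := by gcongr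
      _ = _ := by field_simp
  have h₄ : ‖x‖ * f x ≤ R / Real.log 2 * ((Real.log (f 0) - Real.log (f x)) * f x) := by
    have : ‖x‖ ≤ R / Real.log 2 * (Real.log (f 0) - Real.log (f x)) := by
      rw [div_mul_eq_mul_div, le_div_iff₀ hlog2]
      exact h₃
    calc _ ≤ R / Real.log 2 * (Real.log (f 0) - Real.log (f x)) * f x := by gcongr
      _ = _ := by ring
  have h₅ : (Real.log (f 0) - Real.log (f x)) * f x ≤
      |Real.log (f 0)| * f x + 2 * f x ^ (1 / 2 : ℝ) := by
    have := Real.neg_mul_log_le_two_mul_rpow hfx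
    have : Real.log (f 0) * f x ≤ |Real.log (f 0)| * f x := by
      gcongr
      exact le_abs_self _
    linarith
  have h₆ := h₄.trans (mul_le_mul_of_nonneg_left h₅ (by positivity))
  have : 0 ≤ R * f x := by positivity
  linarith

/-- An integrable log-concave function has a finite first moment. -/
theorem integrable_norm_mul (hf : IsLogConcave f) (hf₀ : ∀ x, 0 ≤ f x) (hint : Integrable f μ) :
    Integrable (fun x => ‖x‖ * f x) μ := by
  by_cases hne : ∫ x, f x ∂μ = 0
  · have h : f =ᵐ[μ] 0 := (integral_eq_zero_iff_of_nonneg hf₀ hint).1 hne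
    refine (integrable_zero E ℝ μ).congr ?_
    filter_upwards [h] with x hx
    simp [hx]
  obtain ⟨c, hc⟩ := hf.nonempty_interior_support hf₀ hne
  have hc' : (0 : E) ∈ interior {x | 0 < f (c + x)} := by
    rw [mem_interior_iff_mem_nhds] at hc ⊢
    have : ContinuousAt (fun x : E => c + x) 0 := by fun_prop
    exact this.preimage_mem_nhds (by simpa using hc)
  have h₁ := (hf.comp_add_left c).integrable_norm_mul_of_zero_mem (fun x => hf₀ _) hc'
    (hint.comp_add_left c)
  have h₂ := h₁.comp_add_left (-c)
  simp only [add_neg_cancel_left] at h₂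
  refine (h₂.add (hint.const_mul ‖c‖)).mono' (continuous_norm.aestronglyMeasurable.mul hint.1)
    (.of_forall fun x => ?_)
  rw [Real.norm_of_nonneg (mul_nonneg (norm_nonneg x) (hf₀ x))]
  have h : ‖x‖ ≤ ‖-c + x‖ + ‖c‖ := by
    simpa using norm_add_le (-c + x) c |>.trans_eq' (by simp)
  calc ‖x‖ * f x ≤ (‖-c + x‖ + ‖c‖) * f x := mul_le_mul_of_nonneg_right h (hf₀ x)
    _ = _ := by simp [add_mul]

theorem integrable_smul_self (hf : IsLogConcave f) (hf₀ : ∀ x, 0 ≤ f x) (hint : Integrable f μ) :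
    Integrable (fun x => f x • x) μ := by
  refine (hf.integrable_norm_mul hf₀ hint).mono' (hint.1.smul aestronglyMeasurable_id)
    (.of_forall fun x => ?_)
  rw [norm_smul, Real.norm_of_nonneg (hf₀ x), mul_comm]

theorem integrable_mul_clm (hf : IsLogConcave f) (hf₀ : ∀ x, 0 ≤ f x) (hint : Integrable f μ)
    (l : E →L[ℝ] ℝ) : Integrable (fun x => f x * l x) μ := by
  simpa using l.integrable_comp (hf.integrable_smul_self hf₀ hint)

theorem integral_mul_clm_eq_zero (hf : IsLogConcave f) (hf₀ : ∀ x, 0 ≤ f x)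
    (hint : Integrable f μ) (hcent : ∫ x, f x • x ∂μ = 0) (l : E →L[ℝ] ℝ) :
    ∫ x, f x * l x ∂μ = 0 := by
  have := l.integral_comp_comm (hf.integrable_smul_self hf₀ hint)
  simpa [hcent] using this

/-- The barycenter of a log-concave density lies in the interior of its support. -/
theorem zero_mem_interior_support (hf : IsLogConcave f) (hf₀ : ∀ x, 0 ≤ f x)
    (hint : Integrable f μ) (hne : ∫ x, f x ∂μ ≠ 0) (hcent : ∫ x, f x • x ∂μ = 0) :
    (0 : E) ∈ interior {x | 0 < f x} := by
  by_contra h₀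
  have hU := hf.nonempty_interior_support hf₀ hne
  obtain ⟨l, hl⟩ := geometric_hahn_banach_open_point hf.convex_support.interior isOpen_interior h₀
  simp only [map_zero] at hl
  have hle : ∀ x, 0 < f x → l x ≤ 0 := by
    intro x hx
    have hx' : x ∈ closure (interior {x | 0 < f x}) := by
      rw [hf.convex_support.closure_interior_eq_closure_of_nonempty_interior hU]
      exact subset_closure hx
    exact closure_minimal (fun y hy => (hl y hy).le) (isClosed_Iic.preimage l.continuous) hx'
  have hnonneg : ∀ x, 0 ≤ -(f x * l x) := by
    intro x
    rcases (hf₀ x).eq_or_lt with h | h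
    · simp [← h]
    · exact neg_nonneg.2 (mul_nonpos_of_nonneg_of_nonpos h.le (hle x h))
  have hzero := (integral_eq_zero_iff_of_nonneg hnonneg (hf.integrable_mul_clm hf₀ hint l).neg).1
    (by
      have := hf.integral_mul_clm_eq_zero hf₀ hint hcent l
      simp [integral_neg, this])
  refine (isOpen_interior.measure_pos μ hU).ne' (measure_mono_null ?_ (ae_iff.1 hzero))
  intro x hx
  have h₁ : 0 < f x := pos_of_mem_interior_support hx
  have h₂ := mul_neg_of_pos_of_neg h₁ (hl x hx)
  simpa using h₂.ne

theorem integrable_mul_log (hf : IsLogConcave f) (hf₀ : ∀ x, 0 ≤ f x)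
    (h₀ : (0 : E) ∈ interior {x | 0 < f x}) (hint : Integrable f μ) :
    Integrable (fun x => f x * Real.log (f x)) μ := by
  have hpos : 0 < f 0 := pos_of_mem_interior_support h₀
  obtain ⟨l, hl⟩ := hf.exists_log_le_add h₀
  have hdom : Integrable (fun x => 2 * f x ^ (1 / 2 : ℝ) +
      (|Real.log (f 0)| * f x + |f x * l x|)) μ :=
    ((hf.integrable_rpow hf₀ hpos hint (by norm_num) (by norm_num)).const_mul 2).add
      ((hint.const_mul _).add (hf.integrable_mul_clm hf₀ hint l).abs)
  refine hdom.mono' (hint.aemeasurable.mul hint.aemeasurable.log).aestronglyMeasurable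
    (.of_forall fun x => ?_)
  have hfx := hf₀ x
  have h₁ := Real.neg_mul_log_le_two_mul_rpow hfx
  have h₂ : 0 ≤ f x ^ (1 / 2 : ℝ) := Real.rpow_nonneg hfx _
  have h₃ : 0 ≤ |Real.log (f 0)| * f x := by positivity
  have h₄ := abs_nonneg (f x * l x)
  rw [Real.norm_eq_abs, abs_le']
  refine ⟨?_, by linarith⟩
  rcases hfx.eq_or_lt with h | h
  · rw [← h, zero_mul]
    positivity
  · have h₅ := mul_le_mul_of_nonneg_left (hl x h) hfx
    rw [sub_zero, mul_add] at h₅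
    have h₆ := le_abs_self (f x * l x)
    have h₇ : f x * Real.log (f 0) ≤ |Real.log (f 0)| * f x := by
      rw [mul_comm]
      gcongr
      exact le_abs_self _
    linarith

theorem integral_mul_log_le (hf : IsLogConcave f) (hf₀ : ∀ x, 0 ≤ f x)
    (hone : ∫ x, f x ∂μ = 1) (hcent : ∫ x, f x • x ∂μ = 0) :
    ∫ x, f x * Real.log (f x) ∂μ ≤ Real.log (f 0) := by
  have hint : Integrable f μ := .of_integral_ne_zero (by simp [hone])
  have h₀ := hf.zero_mem_interior_support hf₀ hint (by simp [hone]) hcent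
  obtain ⟨l, hl⟩ := hf.exists_log_le_add h₀
  calc ∫ x, f x * Real.log (f x) ∂μ ≤ ∫ x, (f x * Real.log (f 0) + f x * l x) ∂μ := by
        refine integral_mono (hf.integrable_mul_log hf₀ h₀ hint)
          ((hint.mul_const _).add (hf.integrable_mul_clm hf₀ hint l)) fun x => ?_
        rcases (hf₀ x).eq_or_lt with h | h
        · simp [← h]
        · simpa [mul_add] using mul_le_mul_of_nonneg_left (hl x h) h.le
    _ = Real.log (f 0) := by
        rw [integral_add (hint.mul_const _) (hf.integrable_mul_clm hf₀ hint l),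
          integral_mul_const, hone, hf.integral_mul_clm_eq_zero hf₀ hint hcent l]
        simp

theorem log_sub_finrank_le_integral_mul_log (hf : IsLogConcave f) (hf₀ : ∀ x, 0 ≤ f x)
    (hone : ∫ x, f x ∂μ = 1) (hcent : ∫ x, f x • x ∂μ = 0) :
    Real.log (f 0) - Module.finrank ℝ E ≤ ∫ x, f x * Real.log (f x) ∂μ := by
  have hint : Integrable f μ := .of_integral_ne_zero (by simp [hone])
  have h₀ := hf.zero_mem_interior_support hf₀ hint (by simp [hone]) hcent
  have hpos : 0 < f 0 := pos_of_mem_interior_support h₀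
  have hlogint := hf.integrable_mul_log hf₀ h₀ hint
  set I := ∫ x, f x * Real.log (f x) ∂μ
  set n := Module.finrank ℝ E
  have hbound : ∀ t : ℝ, 0 < t → t ≤ 1 → 1 + (t - 1) * I ≤ f 0 ^ (t - 1) * (t ^ n)⁻¹ := by
    intro t ht ht'
    have h₁ := hf.integral_rpow_le hf₀ hpos hint ht ht'
    rw [hone, mul_one] at h₁
    refine le_trans ?_ h₁
    calc 1 + (t - 1) * I = ∫ x, (f x + (t - 1) * (f x * Real.log (f x))) ∂μ := by
          rw [integral_add hint (hlogint.const_mul _), integral_const_mul, hone]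
      _ ≤ _ := by
          refine integral_mono (hint.add (hlogint.const_mul _))
            (hf.integrable_rpow hf₀ hpos hint ht ht') fun x => ?_
          have := Real.mul_one_add_mul_log_le_rpow (hf₀ x) t
          dsimp only
          linarith
  have hderiv : HasDerivAt (fun t : ℝ => f 0 ^ (t - 1) * (t ^ n)⁻¹ - (1 + (t - 1) * I))
      (Real.log (f 0) - n - I) 1 := by
    have h₁ : HasDerivAt (fun t : ℝ => f 0 ^ (t - 1)) (Real.log (f 0)) 1 := by
      simpa using ((hasDerivAt_id (1 : ℝ)).sub_const 1).const_rpow hpos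
    have h₂ : HasDerivAt (fun t : ℝ => (t ^ n)⁻¹) (-n) 1 := by
      simpa using (hasDerivAt_pow n (1 : ℝ)).fun_inv (by simp)
    have h₃ : HasDerivAt (fun t : ℝ => 1 + (t - 1) * I) I 1 := by
      simpa using (((hasDerivAt_id (1 : ℝ)).sub_const 1).mul_const I).const_add 1
    refine ((h₁.fun_mul h₂).fun_sub h₃).congr_deriv ?_
    simp
    ring
  have hslope := (hasDerivWithinAt_iff_tendsto_slope' (Set.notMem_Iio.2 le_rfl)).1
    (hderiv.hasDerivWithinAt (s := Set.Iio 1))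
  have hle : Real.log (f 0) - n - I ≤ 0 := by
    refine le_of_tendsto hslope ?_
    filter_upwards [Ioo_mem_nhdsLT (zero_lt_one' ℝ)] with t ht
    have := hbound t ht.1 ht.2.le
    rw [slope_def_field]
    refine div_nonpos_of_nonneg_of_nonpos ?_ (by linarith [ht.2])
    simpa using this
  linarith

end IsLogConcave

/-- For a centered, absolutely-continuous log-concave probability measure on ℝⁿ with
density `f`, the differential entropy satisfies `-log f 0 ≤ Ent(μ) ≤ -log f 0 + n`. -/
theorem stmt0 (n : ℕ) (hn : 0 < n) (f : EuclideanSpace ℝ (Fin n) → ℝ)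
    (hf_meas : Measurable f) (hf_nonneg : ∀ x, 0 ≤ f x)
    (hf_prob : ∫ x, f x = 1)
    (hf_logconcave : ∀ x y : EuclideanSpace ℝ (Fin n), ∀ t : ℝ, 0 ≤ t → t ≤ 1 →
      f x ^ t * f y ^ (1 - t) ≤ f (t • x + (1 - t) • y))
    (hf_centered : ∫ x, f x • x = 0) :
    -Real.log (f 0) ≤ -∫ x, f x * Real.log (f x) ∧
      -∫ x, f x * Real.log (f x) ≤ -Real.log (f 0) + n := by
  have hf : IsLogConcave f := hf_logconcave
  have h₁ := hf.integral_mul_log_le hf_nonneg hf_prob hf_centered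
  have h₂ := hf.log_sub_finrank_le_integral_mul_log hf_nonneg hf_prob hf_centered
  rw [finrank_euclideanSpace_fin] at h₂
  exact ⟨by linarith, by linarith⟩
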